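/- arXiv:1909.04024 — 2 statements merged into one kernel-verified Lean document; each statement's English description precedes it below -/
import Mathlib

section
/- For any β ∈ ℝ^d, the empirical hypervolume under the manifold is bounded below by the Bonferroni-type bound D_E(β) ≥ ∑_{j=1}^{M−1} p̂_j(β) − (M−2), where p̂_j(β) are the empirical pairwise comparison rates. -/
open Finset
open scoped Classical

/-- The empirical hypervolume under the manifold (EHUM). -/
noncomputable def EHUM (d M : ℕ) (n : Fin M → ℕ)
    (X : (j : Fin M) → Fin (n j) → Fin d → ℝ) (β : Fin d → ℝ) : ℝ :=
  (1 / ∏ j, (n j : ℝ)) *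
    ∑ idx : (j : Fin M) → Fin (n j),
      if (∀ (j : ℕ) (h : j + 1 < M),
            ∑ l, β l * X ⟨j, Nat.lt_of_succ_lt h⟩ (idx ⟨j, Nat.lt_of_succ_lt h⟩) l <
              ∑ l, β l * X ⟨j + 1, h⟩ (idx ⟨j + 1, h⟩) l)
      then (1 : ℝ) else 0

/-- The empirical pairwise comparison rate `p̂(β)` between categories `j` and `k`. -/
noncomputable def pairwiseRate (d M : ℕ) (n : Fin M → ℕ)
    (X : (j : Fin M) → Fin (n j) → Fin d → ℝ) (β : Fin d → ℝ) (j k : Fin M) : ℝ :=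
  (1 / ((n j : ℝ) * (n k : ℝ))) *
    ∑ a : Fin (n k), ∑ b : Fin (n j),
      if (∑ l, β l * X j b l < ∑ l, β l * X k a l) then (1 : ℝ) else 0

/-- Resampling one coordinate multiplies the total sum by the number of choices. -/
lemma sum_update_aux {M : ℕ} (n : Fin M → ℕ) (j : Fin M)
    (F : ((i : Fin M) → Fin (n i)) → ℝ) :
    ∑ idx : (i : Fin M) → Fin (n i), ∑ b : Fin (n j), F (Function.update idx j b)
      = (n j : ℝ) * ∑ idx : (i : Fin M) → Fin (n i), F idx := by
  have h1 : ∑ p : ((i : Fin M) → Fin (n i)) × Fin (n j), F (Function.update p.1 j p.2)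
      = ∑ p : ((i : Fin M) → Fin (n i)) × Fin (n j), F p.1 := by
    refine Finset.sum_bij' (fun p _ => (Function.update p.1 j p.2, p.1 j))
      (fun p _ => (Function.update p.1 j p.2, p.1 j)) ?_ ?_ ?_ ?_ ?_
    · simp
    · simp
    · rintro ⟨p, b⟩ _
      simp
    · rintro ⟨p, b⟩ _
      simp
    · simp
  rw [Fintype.sum_prod_type, Fintype.sum_prod_type] at h1
  rw [h1]
  simp [Finset.mul_sum]

/-- Marginalisation of a sum depending on only two coordinates. -/
lemma sum_two_aux {M : ℕ} (n : Fin M → ℕ) (j k : Fin M) (hjk : j ≠ k)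
    (f : Fin (n j) → Fin (n k) → ℝ) :
    ((n j : ℝ) * (n k : ℝ)) * ∑ idx : (i : Fin M) → Fin (n i), f (idx j) (idx k)
      = (∏ i, (n i : ℝ)) * ∑ a : Fin (n k), ∑ b : Fin (n j), f b a := by
  have h1 := sum_update_aux n j (fun idx => f (idx j) (idx k))
  have h2 := sum_update_aux n k (fun idx => ∑ b : Fin (n j), f b (idx k))
  simp only [Function.update_self, Function.update_of_ne hjk.symm] at h1 h2
  rw [mul_comm (n j : ℝ), mul_assoc, ← h1, ← h2]
  simp

/-- For any `β ∈ ℝ^d`, the empirical hypervolume under the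
manifold is bounded below by the Bonferroni-type bound
`D_E(β) ≥ ∑_{j=1}^{M−1} p̂_j(β) − (M−2)`, where `p̂_j(β)` are the empirical
pairwise comparison rates of consecutive categories. -/
theorem EHUM_ge_sum_pairwiseRate (d M : ℕ) (hM : 2 ≤ M)
    (n : Fin M → ℕ) (hn : ∀ j, 1 ≤ n j)
    (X : (j : Fin M) → Fin (n j) → Fin d → ℝ) (β : Fin d → ℝ) :
    (∑ j : Fin (M - 1),
        pairwiseRate d M n X β
          ⟨(j : ℕ), by have := j.2; omega⟩ ⟨(j : ℕ) + 1, by have := j.2; omega⟩)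
      - ((M : ℝ) - 2) ≤ EHUM d M n X β := by
  have hpos : (0 : ℝ) < ∏ i, (n i : ℝ) :=
    Finset.prod_pos fun i _ => by exact_mod_cast hn i
  have hrate : ∀ j k : Fin M, j ≠ k → pairwiseRate d M n X β j k
      = (1 / ∏ i, (n i : ℝ)) * ∑ idx : (i : Fin M) → Fin (n i),
        if (∑ l, β l * X j (idx j) l < ∑ l, β l * X k (idx k) l) then (1 : ℝ) else 0 := by
    intro j k hjk
    have h := sum_two_aux n j k hjk
      (fun b a => if (∑ l, β l * X j b l < ∑ l, β l * X k a l) then (1 : ℝ) else 0)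
    have hj : (0 : ℝ) < n j := by exact_mod_cast hn j
    have hk : (0 : ℝ) < n k := by exact_mod_cast hn k
    unfold pairwiseRate
    rw [one_div_mul_eq_div, one_div_mul_eq_div, div_eq_div_iff (by positivity) hpos.ne']
    linarith
  have hcard : (1 / ∏ i, (n i : ℝ)) * ∑ _idx : (i : Fin M) → Fin (n i), ((M : ℝ) - 2)
      = (M : ℝ) - 2 := by
    simp only [Finset.sum_const, Finset.card_univ, Fintype.card_pi, Fintype.card_fin,
      nsmul_eq_mul, Nat.cast_prod]
    field_simp
  rw [Finset.sum_congr rfl (fun j _ => hrate _ _ (by simp [Fin.ext_iff])), ← Finset.mul_sum]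
  rw [← hcard, ← mul_sub, Finset.sum_comm, ← Finset.sum_sub_distrib]
  unfold EHUM
  refine mul_le_mul_of_nonneg_left (Finset.sum_le_sum fun idx _ => ?_) (by positivity)
  have hM1 : ((M - 1 : ℕ) : ℝ) = (M : ℝ) - 1 := by
    rw [Nat.cast_sub (by omega)]
    simp
  split_ifs with hall
  · have : ∀ j ∈ (Finset.univ : Finset (Fin (M - 1))), (if (∑ l, β l * X ⟨(j : ℕ), by omega⟩ (idx ⟨(j : ℕ), by omega⟩) l
        < ∑ l, β l * X ⟨(j : ℕ) + 1, by omega⟩ (idx ⟨(j : ℕ) + 1, by omega⟩) l)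
        then (1 : ℝ) else 0) ≤ 1 := by
      intro j _
      split_ifs <;> norm_num
    have h2 := Finset.sum_le_sum this
    simp only [Finset.sum_const, Finset.card_univ, Fintype.card_fin, nsmul_eq_mul, hM1] at h2
    linarith
  · push Not at hall
    obtain ⟨j, hj, hle⟩ := hall
    have : ∀ i ∈ (Finset.univ : Finset (Fin (M - 1))), (if (∑ l, β l * X ⟨(i : ℕ), by omega⟩ (idx ⟨(i : ℕ), by omega⟩) l
        < ∑ l, β l * X ⟨(i : ℕ) + 1, by omega⟩ (idx ⟨(i : ℕ) + 1, by omega⟩) l)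
        then (1 : ℝ) else 0) ≤ 1 - (if i = ⟨j, by omega⟩ then (1 : ℝ) else 0) := by
      intro i _
      by_cases hi : i = ⟨j, by omega⟩
      · subst hi
        simp [not_lt.mpr hle]
      · rw [if_neg hi]
        split_ifs <;> norm_num
    have h2 := Finset.sum_le_sum this
    rw [Finset.sum_sub_distrib] at h2
    simp only [Finset.sum_const, Finset.card_univ, Fintype.card_fin, nsmul_eq_mul, hM1,
      Finset.sum_ite_eq', Finset.mem_univ, if_true] at h2
    linarith
end

section
/- Let X be a set and f : X → ℝ be bounded above by B ∈ ℝ. Let tol > 0, ρ > 1, and φ > 0, and let (β_j)_{j≥0} be a sequence in X and (s_j)_{j≥0} a sequence of positive reals such that for every j: f(β_{j+1}) ≥ f(β_j), and either (f(β_{j+1}) ≥ f(β_j) + tol and s_{j+1} = s_j) or s_{j+1} = s_j/ρ. Then there exists an index J such that s_J < φ; that is, each run of the SCOR algorithm (which terminates once the step size falls below the step size threshold φ) terminates after finitely many iterations. -/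
/-- Let `f : X → ℝ` be bounded above by `B`, let `tol > 0`,
`ρ > 1`, `φ > 0`, and let `(β_j)` be a sequence in `X` and `(s_j)` a sequence of
positive step sizes such that at each iteration the objective value does not
decrease, and either the objective improves by at least `tol` with the step
size kept the same, or the step size is divided by `ρ`.  Then some iteration
has step size below the threshold `φ`: each run of the SCOR algorithm
terminates after finitely many iterations. -/
theorem scor_run_terminates {X : Type*} (f : X → ℝ) (B : ℝ)
    (hB : ∀ x, f x ≤ B) (tol ρ φ : ℝ) (htol : 0 < tol) (hρ : 1 < ρ) (hφ : 0 < φ)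
    (β : ℕ → X) (s : ℕ → ℝ) (hs : ∀ j, 0 < s j)
    (hmono : ∀ j, f (β j) ≤ f (β (j + 1)))
    (hstep : ∀ j, (f (β j) + tol ≤ f (β (j + 1)) ∧ s (j + 1) = s j) ∨
      s (j + 1) = s j / ρ) :
    ∃ J : ℕ, s J < φ := by
  by_contra! hcon
  have hL : 0 < Real.log ρ := Real.log_pos hρ
  -- potential function, increasing by at least 1 at each iteration
  have key : ∀ n : ℕ, f (β 0) / tol - Real.log (s 0) / Real.log ρ + n ≤
      f (β n) / tol - Real.log (s n) / Real.log ρ := by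
    intro n
    induction n with
    | zero => simp
    | succ k ih =>
      push_cast
      rcases hstep k with ⟨h1, h2⟩ | h2
      · have h3 : (f (β k) + tol) / tol ≤ f (β (k + 1)) / tol := by gcongr
        rw [add_div, div_self htol.ne'] at h3
        rw [h2]
        linarith
      · have h3 : f (β k) / tol ≤ f (β (k + 1)) / tol := by
          have := hmono k
          gcongr
        rw [h2, Real.log_div (hs k).ne' (by linarith), sub_div, div_self hL.ne']
        linarith
  obtain ⟨n, hn⟩ := exists_nat_gt (B / tol - Real.log φ / Real.log ρ -
    (f (β 0) / tol - Real.log (s 0) / Real.log ρ))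
  have h1 : f (β n) / tol ≤ B / tol := by
    have := hB (β n)
    gcongr
  have h2 : Real.log φ / Real.log ρ ≤ Real.log (s n) / Real.log ρ :=
    div_le_div_of_nonneg_right (Real.log_le_log hφ (hcon n)) hL.le
  have := key n
  linarith
end
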